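/- Let Q = k[[x₁, …, x_c]] with maximal ideal 𝔫 = (x₁, …, x_c), let I = (x₁², …, x_c²), R = Q/I, V = I/𝔫I, and let M = R/(x₁). Then for every f ∈ I with nonzero image f̄ in V: Ext^i_{Q/(f)}(M,k) ≠ 0 for infinitely many i if and only if f̄ lies in the k-span of the image of x₁² in V. (Equivalently, relative to the basis of V given by the images of x₁², …, x_c², one has V_R^1(M,k) = {(1,0,…,0)}.) -/

import Mathlib

open CategoryTheory IsLocalRing

/-- A local ring is regular if its maximal ideal can be generated by a regular sequence. -/
def IsRegularLocal (Q : Type) [CommRing Q] [IsLocalRing Q] : Prop :=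
  ∃ rs : List Q, RingTheory.Sequence.IsRegular Q rs ∧
    Ideal.span {x | x ∈ rs} = maximalIdeal Q

theorem Module.IsTorsionBySet.mono' {Q M : Type} [CommRing Q] [AddCommGroup M] [Module Q M]
    {J I : Ideal Q} (h : Module.IsTorsionBySet Q M (I : Set Q)) (hJI : J ≤ I) :
    Module.IsTorsionBySet Q M (J : Set Q) := fun x a => @h x ⟨a.1, hJI a.2⟩

/-- The `Q ⧸ J`-module structure on a module annihilated by `I ⊇ J`. -/
def modOver {Q : Type} [CommRing Q] {I : Ideal Q} (J : Ideal Q) (hJI : J ≤ I)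
    (M : Type) [AddCommGroup M] [Module Q M]
    (hM : Module.IsTorsionBySet Q M (I : Set Q)) : Module (Q ⧸ J) M :=
  (hM.mono' hJI).module

theorem quot_isTorsionBySet (Q : Type) [CommRing Q] (J : Ideal Q) :
    Module.IsTorsionBySet Q (Q ⧸ J) (J : Set Q) := fun x a => by
  induction x using Quotient.inductionOn with
  | h q =>
    show ((a : Q) • Submodule.Quotient.mk q : Q ⧸ J) = 0
    rw [← Submodule.Quotient.mk_smul, Submodule.Quotient.mk_eq_zero, smul_eq_mul]
    exact Ideal.mul_mem_right q J a.2

/-- The residue field `k = Q/𝔪` as a module over `Q ⧸ J` for any `J ≤ 𝔪`. -/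
def kMod {Q : Type} [CommRing Q] [IsLocalRing Q] (J : Ideal Q) (hJm : J ≤ maximalIdeal Q) :
    Module (Q ⧸ J) (Q ⧸ maximalIdeal Q) :=
  modOver J hJm (Q ⧸ maximalIdeal Q) (quot_isTorsionBySet Q (maximalIdeal Q))

/-- `Ext^i_A(M, N)`, as a module over `A`, for explicitly given module structures. -/
noncomputable def extMod (A : Type) [CommRing A] (M N : Type) [AddCommGroup M] [AddCommGroup N]
    (mM : Module A M) (mN : Module A N) (i : ℕ) : ModuleCat A :=
  ((Ext A (ModuleCat A) i).obj (Opposite.op (@ModuleCat.of A _ M _ mM))).obj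
    (@ModuleCat.of A _ N _ mN)

/-- `Ext^i_A(M, N) ≠ 0` for infinitely many `i`. -/
def extInf (A : Type) [CommRing A] (M N : Type) [AddCommGroup M] [AddCommGroup N]
    (mM : Module A M) (mN : Module A N) : Prop :=
  ∀ n : ℕ, ∃ i, n ≤ i ∧ Nontrivial (extMod A M N mM mN i)

/-- `Ext^i_A(M, N) = 0` for all `i ≫ 0`. -/
def extVan (A : Type) [CommRing A] (M N : Type) [AddCommGroup M] [AddCommGroup N]
    (mM : Module A M) (mN : Module A N) : Prop :=
  ∃ n₀ : ℕ, ∀ i, n₀ ≤ i → Subsingleton (extMod A M N mM mN i)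

/-- The images in `V = I/𝔫I` of the elements `g i` of `I` are `k`-linearly independent. -/
def LinIndepInV (Q : Type) [CommRing Q] [IsLocalRing Q] (I : Ideal Q)
    {d : ℕ} (g : Fin d → Q) : Prop :=
  (∀ i, g i ∈ I) ∧
    ∀ a : Fin d → Q, (∑ i, a i * g i) ∈ maximalIdeal Q * I → ∀ i, a i ∈ maximalIdeal Q

/-- The depth of a module over a local ring: the supremum of the lengths of
regular sequences on the module consisting of elements of the maximal ideal. -/
noncomputable def localDepth (Q : Type) [CommRing Q] [IsLocalRing Q]
    (M : Type) [AddCommGroup M] [Module Q M] : ℕ :=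
  sSup {n | ∃ rs : List Q, rs.length = n ∧ (∀ r ∈ rs, r ∈ maximalIdeal Q) ∧
    RingTheory.Sequence.IsRegular M rs}



theorem oldExt_subsingleton_iff {A : Type} [CommRing A] (X Y : ModuleCat.{0} A) (n : ℕ) :
    Subsingleton (((Ext A (ModuleCat A) (n+1)).obj (Opposite.op X)).obj Y) ↔
      Subsingleton (Abelian.Ext.{0} X Y (n+1)) := by
  let P := projectiveResolution X
  rw [← ModuleCat.isZero_iff_subsingleton, (P.isoExt (R := A) (n+1) Y).isZero_iff,
    ← HomologicalComplex.exactAt_iff_isZero_homology,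
    HomologicalComplex.exactAt_iff' _ n (n+1) (n+2) (by simp) (by simp),
    ShortComplex.moduleCat_exact_iff]
  constructor
  · intro h
    refine ⟨fun a b => ?_⟩
    suffices H : ∀ a : Abelian.Ext.{0} X Y (n+1), a = 0 by rw [H a, H b]
    intro a
    obtain ⟨f, hf, rfl⟩ := P.extMk_surjective a (n+2) rfl
    rw [P.extMk_eq_zero_iff f (n+2) rfl hf n rfl]
    obtain ⟨g, hg⟩ := h f (by exact hf)
    exact ⟨g, hg⟩
  · intro h f hf
    have := (P.extMk_eq_zero_iff (Y := Y) f (n+2) rfl hf n rfl).1 (Subsingleton.elim _ _)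
    obtain ⟨g, hg⟩ := this
    exact ⟨g, hg⟩



section
variable {A : Type} [CommRing A]

/-- Vanishing of `Ext^i(X,K)` for `i ≥ n`. -/
def VanE (K X : ModuleCat.{0} A) (n : ℕ) : Prop :=
  ∀ i, n ≤ i → ∀ z : Abelian.Ext.{0} X K i, z = 0

theorem VanE.mono {K X : ModuleCat.{0} A} {n m : ℕ} (h : VanE K X n) (hnm : n ≤ m) :
    VanE K X m := fun i hi => h i (hnm.trans hi)

theorem VanE.mid {K : ModuleCat.{0} A} {S : ShortComplex (ModuleCat.{0} A)} (hS : S.ShortExact)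
    {n : ℕ} (h1 : VanE K S.X₁ n) (h3 : VanE K S.X₃ n) : VanE K S.X₂ n := by
  intro i hi z
  obtain ⟨y, rfl⟩ := Abelian.Ext.contravariant_sequence_exact₂ hS _ z (h1 i hi _)
  rw [h3 i hi y, Abelian.Ext.comp_zero]

theorem VanE.right {K : ModuleCat.{0} A} {S : ShortComplex (ModuleCat.{0} A)} (hS : S.ShortExact)
    {n : ℕ} (h1 : VanE K S.X₁ n) (h2 : VanE K S.X₂ n) : VanE K S.X₃ (n+1) := by
  intro i hi z
  obtain ⟨j, rfl⟩ : ∃ j, i = 1 + j := ⟨i - 1, by omega⟩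
  obtain ⟨y, rfl⟩ := Abelian.Ext.contravariant_sequence_exact₃ hS _ z (h2 _ (by omega) _) rfl
  rw [h1 j (by omega) y, Abelian.Ext.comp_zero]

theorem VanE.of_projective (K X : ModuleCat.{0} A) [Projective X] : VanE K X 1 := by
  intro i hi z
  obtain ⟨j, rfl⟩ : ∃ j, i = j + 1 := ⟨i - 1, by omega⟩
  exact Abelian.Ext.eq_zero_of_projective z

/-- An element killing `K` kills `Ext(X,K)`. -/
theorem smul_id_comp_zero {K X : ModuleCat.{0} A} {a : A} (ha : a • (𝟙 K) = 0) {i : ℕ}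
    (z : Abelian.Ext.{0} X K i) :
    (Abelian.Ext.mk₀ (a • (𝟙 X))).comp z (zero_add i) = 0 := by
  rw [Abelian.Ext.mk₀_smul, Abelian.Ext.smul_comp, Abelian.Ext.mk₀_id_comp,
    Abelian.Ext.smul_eq_comp_mk₀, ha, Abelian.Ext.mk₀_zero, Abelian.Ext.comp_zero]

/-- The abstract step: `θ² = aχ` acts as zero. -/
theorem VanE.step {K N M E Z P : ModuleCat.{0} A} {a : A} (ha : a • (𝟙 K) = 0)
    (u : N ⟶ M) (v : M ⟶ N) (huv : u ≫ v = 0) (h2 : (ShortComplex.mk u v huv).ShortExact)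
    (i : Z ⟶ P) (p : P ⟶ N) (hip : i ≫ p = 0) (h1 : (ShortComplex.mk i p hip).ShortExact)
    (s : N ⟶ E) (t : E ⟶ Z) (hst : s ≫ t = 0) (h3 : (ShortComplex.mk s t hst).ShortExact)
    (π : P ⟶ M) (hπ : π ≫ v = p) (φ : E ⟶ M)
    (hφ1 : s ≫ φ = a • u)
    (hφ2 : φ ≫ v ≫ u = t ≫ i ≫ π)
    {n : ℕ} (hM : VanE K M n) : VanE K N n := by
  have := h2.mono_f
  obtain ⟨g, hg⟩ : ∃ g : Z ⟶ N, g ≫ u = i ≫ π :=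
    ⟨h2.exact.lift (i ≫ π) (by simp [hπ, hip]), h2.exact.lift_f _ _⟩
  have hg2 : t ≫ g = φ ≫ v := by
    have : Mono u := this
    rw [← cancel_mono u, Category.assoc, hg, Category.assoc, hφ2]
  have c1 := ShortComplex.ShortExact.extClass_naturality h1 h2
    { τ₁ := g, τ₂ := π, τ₃ := 𝟙 N, comm₁₂ := hg, comm₂₃ := by simpa using hπ }
  have c2 := ShortComplex.ShortExact.extClass_naturality h3 h2
    { τ₁ := a • 𝟙 N, τ₂ := φ, τ₃ := g, comm₁₂ := by simp [hφ1], comm₂₃ := by simp [hg2] }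
  dsimp at c1 c2
  rw [Abelian.Ext.mk₀_id_comp] at c1
  have inj : ∀ j, n ≤ j → ∀ z : Abelian.Ext.{0} N K j,
      h2.extClass.comp z rfl = 0 → z = 0 := by
    intro j hj z hz
    obtain ⟨y, rfl⟩ := Abelian.Ext.contravariant_sequence_exact₁ h2 _ z rfl hz
    rw [hM j hj y, Abelian.Ext.comp_zero]
  intro j hj z
  apply inj j hj z
  apply inj (1+j) (by omega)
  have : (Abelian.Ext.mk₀ g).comp (h2.extClass.comp z rfl) (zero_add (1+j)) = 0 := by
    rw [← Abelian.Ext.comp_assoc (a₁₂ := 1) _ _ _ (by lia) (by lia) (by lia), ← c2,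
      Abelian.Ext.comp_assoc (a₂₃ := j) _ _ _ (by lia) (by lia) (by lia),
      smul_id_comp_zero ha, Abelian.Ext.comp_zero]
  rw [← c1, Abelian.Ext.comp_assoc (a₂₃ := 1+j) _ _ _ (by lia) (by lia) (by lia), c1, this,
    Abelian.Ext.comp_zero]

/-- cyclic module -/
abbrev cyc (𝔞 : Ideal A) : ModuleCat.{0} A := ModuleCat.of A (A ⧸ 𝔞)

def cycMap (x : A) (𝔞 𝔴 : Ideal A) (h : ∀ g ∈ 𝔞, x * g ∈ 𝔴) : cyc 𝔞 ⟶ cyc 𝔴 :=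
  ModuleCat.ofHom (Submodule.mapQ 𝔞 𝔴 (LinearMap.mulLeft A x) h)

theorem cyc_hom_ext {𝔞 : Ideal A} {X : ModuleCat.{0} A} {φ ψ : cyc 𝔞 ⟶ X}
    (h : φ.hom (Submodule.Quotient.mk (1 : A)) = ψ.hom (Submodule.Quotient.mk 1)) : φ = ψ := by
  apply ModuleCat.hom_ext
  refine LinearMap.ext fun y => ?_
  obtain ⟨y, rfl⟩ := Submodule.Quotient.mk_surjective _ y
  have e : (Submodule.Quotient.mk y : A ⧸ 𝔞) = y • Submodule.Quotient.mk 1 := by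
    rw [← Submodule.Quotient.mk_smul, smul_eq_mul, mul_one]
  rw [e, map_smul, map_smul, h]

@[simp] theorem cycMap_mk (x : A) (𝔞 𝔴 : Ideal A) (h : ∀ g ∈ 𝔞, x * g ∈ 𝔴) (g : A) :
    (cycMap x 𝔞 𝔴 h).hom (Submodule.Quotient.mk g) = Submodule.Quotient.mk (x * g) := rfl

theorem cycMap_comp (x y z : A) (𝔞 𝔟 𝔠 : Ideal A) (h h' h'') (e : z = x * y) :
    cycMap x 𝔞 𝔟 h ≫ cycMap y 𝔟 𝔠 h' = cycMap z 𝔞 𝔠 h'' := by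
  apply cyc_hom_ext
  rw [ModuleCat.comp_apply, cycMap_mk, cycMap_mk, cycMap_mk, e, mul_one, mul_one, mul_comm]

theorem cycMap_eq_zero (x : A) (𝔞 𝔴 : Ideal A) (h) (hx : x ∈ 𝔴) : cycMap x 𝔞 𝔴 h = 0 := by
  apply cyc_hom_ext
  rw [cycMap_mk, mul_one]
  exact (Submodule.Quotient.mk_eq_zero _).2 hx

theorem cycMap_smul_id (x : A) (𝔞 : Ideal A) (h) : cycMap x 𝔞 𝔞 h = x • 𝟙 _ := by
  apply cyc_hom_ext
  rw [cycMap_mk]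
  rfl

theorem smul_id_cyc (x : A) (𝔞 : Ideal A) (h : x ∈ 𝔞) : x • 𝟙 (cyc 𝔞) = 0 := by
  rw [← cycMap_smul_id x 𝔞 (fun g hg => 𝔞.mul_mem_left x hg)]
  exact cycMap_eq_zero _ _ _ _ h

theorem cycMap_comp_zero (x : A) (𝔞 𝔴 𝔠 : Ideal A) (h) (h') (h1 : x ∈ 𝔠) :
    cycMap x 𝔞 𝔴 h ≫ cycMap 1 𝔴 𝔠 h' = 0 := by
  rw [cycMap_comp x 1 x 𝔞 𝔴 𝔠 h h' (fun g hg => 𝔠.mul_mem_right _ h1) (by simp)]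
  exact cycMap_eq_zero _ _ _ _ h1

theorem cyc_shortExact (x : A) (𝔞 𝔴 𝔠 : Ideal A) (h) (h') (hz)
    (hinj : ∀ g, x * g ∈ 𝔴 → g ∈ 𝔞) (hc : 𝔠 ≤ 𝔴 ⊔ Ideal.span {x}) :
    (ShortComplex.mk (cycMap x 𝔞 𝔴 h) (cycMap 1 𝔴 𝔠 h') hz).ShortExact := by
  have e1 : Mono (cycMap x 𝔞 𝔴 h) := by
    rw [ModuleCat.mono_iff_injective, injective_iff_map_eq_zero]
    intro y hy
    obtain ⟨y, rfl⟩ := Submodule.Quotient.mk_surjective _ y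
    exact (Submodule.Quotient.mk_eq_zero _).2 (hinj _ ((Submodule.Quotient.mk_eq_zero _).1 hy))
  have e2 : Epi (cycMap 1 𝔴 𝔠 h') := by
    rw [ModuleCat.epi_iff_surjective]
    intro y
    obtain ⟨y, rfl⟩ := Submodule.Quotient.mk_surjective _ y
    exact ⟨Submodule.Quotient.mk y, by rw [cycMap_mk, one_mul]⟩
  refine ShortComplex.ShortExact.mk' ?_ e1 e2
  rw [ShortComplex.moduleCat_exact_iff]
  intro y hy
  obtain ⟨y, rfl⟩ := Submodule.Quotient.mk_surjective _ y
  have hy' : y ∈ 𝔠 := by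
    have := (Submodule.Quotient.mk_eq_zero _).1 hy
    simpa using this
  obtain ⟨w, hw, v, hv, rfl⟩ := Submodule.mem_sup.1 (hc hy')
  obtain ⟨q, rfl⟩ := Ideal.mem_span_singleton'.1 hv
  refine ⟨Submodule.Quotient.mk q, ?_⟩
  change Submodule.Quotient.mk (x * q) = Submodule.Quotient.mk (w + q * x)
  rw [eq_comm, Submodule.Quotient.eq]
  convert hw using 1
  simp [mul_comm]
end



section
variable {Q : Type} [CommRing Q]

abbrev cq (f : Q) (J : Ideal Q) : Ideal (Q ⧸ Ideal.span {f}) := J.map (Ideal.Quotient.mk _)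

theorem mem_cq {f q : Q} {J : Ideal Q} :
    Ideal.Quotient.mk (Ideal.span {f}) q ∈ cq f J ↔ q ∈ J ⊔ Ideal.span {f} := by
  exact Ideal.mem_quotient_iff_mem_sup

theorem mem_cq' {f q : Q} {J : Ideal Q} (hf : f ∈ J) :
    Ideal.Quotient.mk (Ideal.span {f}) q ∈ cq f J ↔ q ∈ J := by
  rw [mem_cq, sup_eq_left.2 ((Ideal.span_singleton_le_iff_mem _).2 hf)]

theorem step_cq (f x a j : Q) (J : Ideal Q) (hj : j ∈ J) (hf : f = j + a * x ^ 2)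
    (hx : ∀ q, x * q ∈ J → q ∈ J) (hnz : ∀ q, f * q = 0 → q = 0)
    (K : ModuleCat.{0} (Q ⧸ Ideal.span {f}))
    (ha : (Ideal.Quotient.mk (Ideal.span {f}) a) • (𝟙 K) = 0) (n : ℕ)
    (hM : VanE K (cyc (cq f (J ⊔ Ideal.span {x ^ 2}))) n) :
    VanE K (cyc (cq f (J ⊔ Ideal.span {x}))) n := by
  set A := Q ⧸ Ideal.span {f} with hA
  set 𝔞 : Ideal Q := J ⊔ Ideal.span {x} with h𝔞
  set 𝔪 : Ideal Q := J ⊔ Ideal.span {x ^ 2} with h𝔪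
  let mk : Q →+* A := Ideal.Quotient.mk (Ideal.span {f})
  have hsurj : Function.Surjective (algebraMap Q A) := Ideal.Quotient.mk_surjective
  have hfm : f ∈ 𝔪 := by
    rw [hf]
    exact add_mem (Ideal.mem_sup_left hj) (Ideal.mem_sup_right
      (Ideal.mul_mem_left _ _ (Ideal.mem_span_singleton_self _)))
  have hx𝔞 : x ∈ 𝔞 := Ideal.mem_sup_right (Ideal.mem_span_singleton_self _)
  have hm𝔞 : 𝔪 ≤ 𝔞 := by
    refine sup_le le_sup_left ?_
    rw [Ideal.span_singleton_le_iff_mem, sq]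
    exact Ideal.mul_mem_left _ _ hx𝔞
  have hf𝔞 : f ∈ 𝔞 := hm𝔞 hfm
  have hx𝔪 : ∀ q ∈ 𝔞, x * q ∈ 𝔪 := by
    intro q hq
    obtain ⟨y, hy, z, hz, rfl⟩ := Submodule.mem_sup.1 hq
    obtain ⟨r, rfl⟩ := Ideal.mem_span_singleton'.1 hz
    rw [mul_add]
    refine add_mem (Ideal.mem_sup_left (Ideal.mul_mem_left _ _ hy)) (Ideal.mem_sup_right ?_)
    exact Ideal.mem_span_singleton'.2 ⟨r, by ring⟩
  have hx𝔪' : ∀ q, x * q ∈ 𝔪 → q ∈ 𝔞 := by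
    intro q hq
    obtain ⟨y, hy, z, hz, h⟩ := Submodule.mem_sup.1 hq
    obtain ⟨r, rfl⟩ := Ideal.mem_span_singleton'.1 hz
    have : q - r * x ∈ J := hx _ (by
      have : x * (q - r * x) = y := by linear_combination -h
      rwa [this])
    have h2 := add_mem (Ideal.mem_sup_left this : q - r * x ∈ 𝔞) (Ideal.mul_mem_left 𝔞 r hx𝔞)
    simpa using h2
  -- the second exact sequence
  have hu : ∀ g ∈ cq f 𝔞, mk x * g ∈ cq f 𝔪 := by
    intro g hg
    obtain ⟨g, rfl⟩ := Ideal.Quotient.mk_surjective g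
    rw [mem_cq' hf𝔞] at hg
    rw [← map_mul, mem_cq' hfm]
    exact hx𝔪 g hg
  have hv : ∀ g ∈ cq f 𝔪, 1 * g ∈ cq f 𝔞 := by
    intro g hg
    rw [one_mul]
    exact Ideal.map_mono hm𝔞 hg
  have huv := cycMap_comp_zero (mk x) (cq f 𝔞) (cq f 𝔪) (cq f 𝔞) hu hv
    (Ideal.mem_map_of_mem _ hx𝔞)
  have h2 := cyc_shortExact (mk x) (cq f 𝔞) (cq f 𝔪) (cq f 𝔞) hu hv huv (by
      intro g hg
      obtain ⟨g, rfl⟩ := Ideal.Quotient.mk_surjective g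
      rw [← map_mul, mem_cq' hfm] at hg
      rw [mem_cq' hf𝔞]
      exact hx𝔪' g hg) (by
      rw [h𝔞, cq, Ideal.map_sup, Ideal.map_span, Set.image_singleton]
      refine sup_le_sup_right (Ideal.map_mono le_sup_left) _)
  -- the first exact sequence
  let Z : ModuleCat A := ModuleCat.of A (cq f 𝔞)
  let P : ModuleCat A := ModuleCat.of A A
  let i : Z ⟶ P := ModuleCat.ofHom (Submodule.subtype (cq f 𝔞))
  let p : P ⟶ cyc (cq f 𝔞) := ModuleCat.ofHom (Submodule.mkQ (cq f 𝔞))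
  have hip : i ≫ p = 0 := by
    apply ModuleCat.hom_ext
    refine LinearMap.ext fun y => ?_
    exact (Submodule.Quotient.mk_eq_zero _).2 y.2
  have h1 : (ShortComplex.mk i p hip).ShortExact := by
    refine ShortComplex.ShortExact.mk' ?_ ?_ ?_
    · rw [ShortComplex.moduleCat_exact_iff]
      intro y hy
      exact ⟨⟨y, (Submodule.Quotient.mk_eq_zero _).1 hy⟩, rfl⟩
    · exact (ModuleCat.mono_iff_injective _).2 Subtype.val_injective
    · exact (ModuleCat.epi_iff_surjective _).2 (Submodule.mkQ_surjective _)
  let π : P ⟶ cyc (cq f 𝔪) := ModuleCat.ofHom (Submodule.mkQ (cq f 𝔪))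
  have hπ : π ≫ cycMap 1 (cq f 𝔪) (cq f 𝔞) hv = p := by
    apply ModuleCat.hom_ext
    refine LinearMap.ext fun y => ?_
    change Submodule.Quotient.mk (1 * y) = Submodule.Quotient.mk y
    rw [one_mul]
  -- the third
  let E' : Type := 𝔞 ⧸ (Ideal.span {f} • ⊤ : Submodule Q 𝔞)
  let E : ModuleCat A := ModuleCat.of A E'
  have tow : IsScalarTower Q A E' := inferInstance
  let e : 𝔞 → E' := Submodule.Quotient.mk
  have he : ∀ (q : Q) (y : 𝔞), mk q • e y = e (q • y) := fun q y => rfl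
  have he0 : ∀ (y : 𝔞), e y = 0 ↔ ∃ q ∈ 𝔞, (y : Q) = f * q := by
    intro y
    change Submodule.Quotient.mk y = (0 : E') ↔ _
    rw [Submodule.Quotient.mk_eq_zero, Submodule.ideal_span_singleton_smul,
      Submodule.mem_smul_pointwise_iff_exists]
    constructor
    · rintro ⟨b, -, rfl⟩
      exact ⟨b, b.2, rfl⟩
    · rintro ⟨b, hb, h⟩
      exact ⟨⟨b, hb⟩, trivial, Subtype.ext h.symm⟩
  let s : cyc (cq f 𝔞) ⟶ E := ModuleCat.ofHom
    (Submodule.liftQ (cq f 𝔞) (LinearMap.toSpanSingleton A E' (e ⟨f, hf𝔞⟩)) (by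
      intro g hg
      obtain ⟨g, rfl⟩ := Ideal.Quotient.mk_surjective g
      rw [mem_cq' hf𝔞] at hg
      rw [LinearMap.mem_ker, LinearMap.toSpanSingleton_apply]
      refine (he0 (g • ⟨f, hf𝔞⟩)).2 ⟨g, hg, mul_comm _ _⟩))
  have hs : ∀ q : Q, s.hom (Submodule.Quotient.mk (mk q)) = e (q • ⟨f, hf𝔞⟩) := fun q => rfl
  let t0 : 𝔞 →ₗ[Q] cq f 𝔞 :=
    { toFun := fun y => ⟨mk y, Ideal.mem_map_of_mem _ y.2⟩
      map_add' := fun y z => Subtype.ext (map_add mk _ _)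
      map_smul' := fun q y => Subtype.ext (map_mul mk _ _) }
  let t1 : E' →ₗ[Q] cq f 𝔞 := Submodule.liftQ _ t0 (by
      rw [Submodule.ideal_span_singleton_smul]
      intro y hy
      obtain ⟨b, -, rfl⟩ := (Submodule.mem_smul_pointwise_iff_exists _ _ _).1 hy
      rw [LinearMap.mem_ker]
      refine Subtype.ext ?_
      change mk (f * b) = 0
      exact Ideal.Quotient.eq_zero_iff_mem.2 (Ideal.mul_mem_right _ _
        (Ideal.mem_span_singleton_self _)))
  let t : E ⟶ Z := ModuleCat.ofHom (LinearMap.extendScalarsOfSurjective hsurj t1)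
  have ht : ∀ y : 𝔞, t.hom (e y) = (⟨mk y, Ideal.mem_map_of_mem _ y.2⟩ : cq f 𝔞) := fun y => rfl
  have hst : s ≫ t = 0 := by
    apply cyc_hom_ext
    change t.hom (s.hom (Submodule.Quotient.mk (mk 1))) = 0
    rw [hs, ht]
    refine Subtype.ext ?_
    change mk (1 * f) = 0
    exact Ideal.Quotient.eq_zero_iff_mem.2 (Ideal.mul_mem_left _ _
        (Ideal.mem_span_singleton_self _))
  have h3 : (ShortComplex.mk s t hst).ShortExact := by
    refine ShortComplex.ShortExact.mk' ?_ ?_ ?_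
    · rw [ShortComplex.moduleCat_exact_iff]
      intro y hy
      obtain ⟨y, rfl⟩ := Submodule.Quotient.mk_surjective _ y
      have h0 : mk y = 0 := congrArg Subtype.val hy
      obtain ⟨q, hq⟩ := Ideal.mem_span_singleton'.1 (Ideal.Quotient.eq_zero_iff_mem.1 h0)
      refine ⟨Submodule.Quotient.mk (mk q), (hs q).trans ?_⟩
      exact congrArg e (Subtype.ext hq)
    · refine (ModuleCat.mono_iff_injective _).2 ?_
      rw [injective_iff_map_eq_zero]
      intro y hy
      obtain ⟨y, rfl⟩ := Submodule.Quotient.mk_surjective _ y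
      obtain ⟨y, rfl⟩ := Ideal.Quotient.mk_surjective y
      obtain ⟨q, hq, h⟩ := (he0 _).1 hy
      have h' : y * f = f * q := h
      have : y = q := sub_eq_zero.1 (hnz _ (by linear_combination h'))
      rw [this]
      exact (Submodule.Quotient.mk_eq_zero _).2 ((mem_cq' hf𝔞).2 hq)
    · refine (ModuleCat.epi_iff_surjective _).2 ?_
      rintro ⟨y, hy⟩
      obtain ⟨y, rfl⟩ := Ideal.Quotient.mk_surjective y
      exact ⟨e ⟨y, (mem_cq' hf𝔞).1 hy⟩, rfl⟩
  -- the map φ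
  have hch : ∀ y : 𝔞, ∃ q : Q, (y : Q) - x * q ∈ J := by
    rintro ⟨y, hy⟩
    obtain ⟨w, hw, z, hz, rfl⟩ := Submodule.mem_sup.1 hy
    obtain ⟨r, rfl⟩ := Ideal.mem_span_singleton'.1 hz
    exact ⟨r, by simpa [mul_comm] using hw⟩
  choose c hc using hch
  have hcu : ∀ (y : 𝔞) (q : Q), (y : Q) - x * q ∈ J → c y - q ∈ J := by
    intro y q hq
    apply hx
    have := sub_mem hq (hc y)
    convert this using 1
    ring
  let F : Q → (A ⧸ cq f 𝔪) := fun q => Submodule.Quotient.mk (mk q)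
  have hF : ∀ q r : Q, q - r ∈ J → F q = F r := by
    intro q r h
    refine (Submodule.Quotient.eq _).2 ?_
    rw [← map_sub]
    exact Ideal.mem_map_of_mem _ (Ideal.mem_sup_left h)
  let φ0 : 𝔞 →ₗ[Q] (A ⧸ cq f 𝔪) :=
    { toFun := fun y => F (c y)
      map_add' := fun y z => by
        refine hF _ (c y + c z) (hcu _ _ ?_)
        convert add_mem (hc y) (hc z) using 1
        push_cast
        ring
      map_smul' := fun q y => by
        refine hF _ (q * c y) (hcu _ _ ?_)
        convert J.mul_mem_left q (hc y) using 1
        simp only [SetLike.val_smul, smul_eq_mul]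
        ring }
  let φ1 : E' →ₗ[Q] (A ⧸ cq f 𝔪) := Submodule.liftQ _ φ0 (by
      rw [Submodule.ideal_span_singleton_smul]
      intro y hy
      obtain ⟨b, -, rfl⟩ := (Submodule.mem_smul_pointwise_iff_exists _ _ _).1 hy
      rw [LinearMap.mem_ker, map_smul]
      obtain ⟨q, hq⟩ := Submodule.Quotient.mk_surjective _ (φ0 b)
      obtain ⟨q, rfl⟩ := Ideal.Quotient.mk_surjective q
      rw [← hq]
      refine (Submodule.Quotient.mk_eq_zero _).2 ?_
      change mk (f * q) ∈ _
      exact Ideal.mem_map_of_mem _ (Ideal.mul_mem_right _ _ hfm))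
  let φ : E ⟶ cyc (cq f 𝔪) := ModuleCat.ofHom (LinearMap.extendScalarsOfSurjective hsurj φ1)
  have hφe : ∀ y : 𝔞, φ.hom (e y) = F (c y) := fun y => rfl
  refine VanE.step ha _ _ huv h2 i p hip h1 s t hst h3 π hπ φ ?_ ?_ hM
  · apply cyc_hom_ext
    change φ.hom (s.hom (Submodule.Quotient.mk (mk 1))) = _
    rw [hs, hφe, hF _ (a * x) (hcu _ _ ?_)]
    · change F (a * x) = mk a • Submodule.Quotient.mk (mk x * 1)
      rw [mul_one]
      rfl
    · have : ((1 : Q) • f) - x * (a * x) = j := by rw [one_smul, hf]; ring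
      change ((1 : Q) • f) - x * (a * x) ∈ J
      rwa [this]
  · apply ModuleCat.hom_ext
    refine LinearMap.ext fun y => ?_
    obtain ⟨y, rfl⟩ := Submodule.Quotient.mk_surjective _ y
    change Submodule.Quotient.mk (mk x * (1 * mk (c y))) = Submodule.Quotient.mk (mk y)
    rw [one_mul, ← map_mul, eq_comm]
    refine (Submodule.Quotient.eq _).2 ?_
    rw [← map_sub]
    exact Ideal.mem_map_of_mem _ (Ideal.mem_sup_left (hc y))
end



section
variable {A : Type} [CommRing A]

theorem one_mul_mem_of_le {𝔞 𝔟 : Ideal A} (h : 𝔞 ≤ 𝔟) : ∀ g ∈ 𝔞, (1 : A) * g ∈ 𝔟 := by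
  intro g hg
  rw [one_mul]
  exact h hg

/-- Properties of the partial Koszul quotient `A/𝔟`. -/
structure GoodE (𝔟 𝔪 : Ideal A) (h : 𝔟 ≤ 𝔪) (s : ℕ) : Prop where
  van : VanE (cyc 𝔪) (cyc 𝔟) (s + 1)
  surj : ∀ z : Abelian.Ext.{0} (cyc 𝔟) (cyc 𝔪) s, ∃ y : Abelian.Ext.{0} (cyc 𝔪) (cyc 𝔪) s,
    (Abelian.Ext.mk₀ (cycMap 1 𝔟 𝔪 (one_mul_mem_of_le h))).comp y (zero_add s) = z
  nontriv : ∃ z : Abelian.Ext.{0} (cyc 𝔟) (cyc 𝔪) s, z ≠ 0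

theorem goodE_zero (𝔟 𝔪 : Ideal A) (h : 𝔟 ≤ 𝔪) (h𝔟 : 𝔟 = ⊥) (h𝔪 : (1 : A) ∉ 𝔪) :
    GoodE 𝔟 𝔪 h 0 := by
  subst h𝔟
  have : Module.Projective A (A ⧸ (⊥ : Ideal A)) :=
    Module.Projective.of_equiv (Submodule.quotEquivOfEqBot (⊥ : Ideal A) rfl).symm
  have hP : Projective (cyc (⊥ : Ideal A)) := by
    rw [← IsProjective.iff_projective]
    exact this
  refine ⟨VanE.of_projective _ _, ?_, ?_⟩
  · intro z
    obtain ⟨g, rfl⟩ := (Abelian.Ext.mk₀_bijective _ _).2 z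
    obtain ⟨q, hq⟩ := Submodule.Quotient.mk_surjective _ (g.hom (Submodule.Quotient.mk 1))
    refine ⟨Abelian.Ext.mk₀ (cycMap q 𝔪 𝔪 (fun g hg => 𝔪.mul_mem_left q hg)), ?_⟩
    rw [Abelian.Ext.mk₀_comp_mk₀]
    congr 1
    apply cyc_hom_ext
    rw [← hq, ModuleCat.comp_apply, cycMap_mk, cycMap_mk, mul_one, mul_one]
  · refine ⟨Abelian.Ext.mk₀ (cycMap 1 _ _ (one_mul_mem_of_le h)), fun h0 => h𝔪 ?_⟩
    rw [Abelian.Ext.mk₀_eq_zero_iff] at h0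
    have := congrArg (fun φ => φ.hom (Submodule.Quotient.mk (1 : A))) h0
    have h1 := (Submodule.Quotient.mk_eq_zero _).1 this
    simpa using h1

theorem goodE_succ (x : A) (𝔟 𝔟' 𝔴 𝔪 : Ideal A) (h𝔟 : 𝔟 ≤ 𝔪) (h𝔟' : 𝔟' ≤ 𝔪) (s : ℕ)
    (hG : GoodE 𝔟 𝔪 h𝔟 s) (hinj : ∀ g, x * g ∈ 𝔟 → g ∈ 𝔟) (heq : 𝔟' = 𝔟 ⊔ Ideal.span {x})
    (h𝔟𝔴 : 𝔟 ≤ 𝔴) (h𝔴𝔪 : 𝔴 ≤ 𝔪) (hx : x ∈ 𝔪)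
    (hx1 : ∀ g ∈ 𝔪, x * g ∈ 𝔴) (hx2 : ∀ g, x * g ∈ 𝔴 → g ∈ 𝔪)
    (hx3 : 𝔪 ≤ 𝔴 ⊔ Ideal.span {x}) : GoodE 𝔟' 𝔪 h𝔟' (s + 1) := by
  have hx' : x ∈ 𝔟' := heq ▸ Ideal.mem_sup_right (Ideal.mem_span_singleton_self _)
  have hbb : 𝔟 ≤ 𝔟' := heq ▸ le_sup_left
  have hx𝔟 : ∀ g ∈ 𝔟, x * g ∈ 𝔟 := fun g hg => 𝔟.mul_mem_left x hg
  have hz1 := cycMap_comp_zero x 𝔟 𝔟 𝔟' hx𝔟 (one_mul_mem_of_le hbb) hx'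
  have S1 := cyc_shortExact x 𝔟 𝔟 𝔟' hx𝔟 (one_mul_mem_of_le hbb) hz1 hinj heq.le
  have hz2 := cycMap_comp_zero x 𝔪 𝔴 𝔪 hx1 (one_mul_mem_of_le h𝔴𝔪) hx
  have S2 := cyc_shortExact x 𝔪 𝔴 𝔪 hx1 (one_mul_mem_of_le h𝔴𝔪) hz2 hx2 hx3
  have hx𝔴 : ∀ g ∈ 𝔟, x * g ∈ 𝔴 := fun g hg => h𝔟𝔴 (hx𝔟 g hg)
  have nat := ShortComplex.ShortExact.extClass_naturality S1 S2
    { τ₁ := cycMap 1 𝔟 𝔪 (one_mul_mem_of_le h𝔟)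
      τ₂ := cycMap 1 𝔟 𝔴 (one_mul_mem_of_le h𝔟𝔴)
      τ₃ := cycMap 1 𝔟' 𝔪 (one_mul_mem_of_le h𝔟')
      comm₁₂ := by
        dsimp
        rw [cycMap_comp 1 x x 𝔟 𝔪 𝔴 _ _ hx𝔴 (by simp), cycMap_comp x 1 x 𝔟 𝔟 𝔴 _ _ hx𝔴 (by simp)]
      comm₂₃ := by
        dsimp
        rw [cycMap_comp 1 1 1 𝔟 𝔴 𝔪 _ _ (one_mul_mem_of_le h𝔟) (by simp),
          cycMap_comp 1 1 1 𝔟 𝔟' 𝔪 _ _ (one_mul_mem_of_le h𝔟) (by simp)] }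
  dsimp at nat
  refine ⟨VanE.right S1 hG.van hG.van, ?_, ?_⟩
  · intro z
    obtain ⟨w, rfl⟩ := Abelian.Ext.contravariant_sequence_exact₃ S1 _ z
      (hG.van _ le_rfl _) (add_comm 1 s)
    obtain ⟨y, rfl⟩ := hG.surj w
    refine ⟨S2.extClass.comp y (add_comm 1 s), ?_⟩
    rw [← Abelian.Ext.comp_assoc (a₁₂ := 1) _ _ _ (by lia) (by lia) (by lia)]
    erw [← nat]
    rw [Abelian.Ext.comp_assoc (a₂₃ := s) _ _ _ (by lia) (by lia) (by lia)]
  · obtain ⟨z, hz⟩ := hG.nontriv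
    refine ⟨S1.extClass.comp z (add_comm 1 s), fun h0 => hz ?_⟩
    obtain ⟨w, rfl⟩ := Abelian.Ext.contravariant_sequence_exact₁ S1 _ z _ h0
    dsimp
    rw [cycMap_smul_id]
    exact smul_id_comp_zero (smul_id_cyc x 𝔪 hx) w

theorem not_vanE_residue (x : A) (𝔟 𝔪 : Ideal A) (h𝔟 : 𝔟 ≤ 𝔪) (s : ℕ)
    (hG : GoodE 𝔟 𝔪 h𝔟 s) (hx : x ∈ 𝔪)
    (hx1 : ∀ g ∈ 𝔪, x * g ∈ 𝔟) (hx2 : ∀ g, x * g ∈ 𝔟 → g ∈ 𝔪)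
    (hx3 : 𝔪 ≤ 𝔟 ⊔ Ideal.span {x}) (n : ℕ) : ¬ VanE (cyc 𝔪) (cyc 𝔪) n := by
  have hz2 := cycMap_comp_zero x 𝔪 𝔟 𝔪 hx1 (one_mul_mem_of_le h𝔟) hx
  have S2 := cyc_shortExact x 𝔪 𝔟 𝔪 hx1 (one_mul_mem_of_le h𝔟) hz2 hx2 hx3
  have surj : ∀ i, s ≤ i → ∀ z : Abelian.Ext.{0} (cyc 𝔟) (cyc 𝔪) i,
      ∃ y : Abelian.Ext.{0} (cyc 𝔪) (cyc 𝔪) i,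
      (Abelian.Ext.mk₀ (cycMap 1 𝔟 𝔪 (one_mul_mem_of_le h𝔟))).comp y (zero_add i) = z := by
    intro i hi z
    rcases hi.eq_or_lt with rfl | hi
    · exact hG.surj z
    · exact ⟨0, by rw [hG.van i hi z, Abelian.Ext.comp_zero]⟩
  have key : ∀ m, ∃ z : Abelian.Ext.{0} (cyc 𝔪) (cyc 𝔪) (s + m), z ≠ 0 := by
    intro m
    induction m with
    | zero =>
      obtain ⟨z, hz⟩ := hG.nontriv
      obtain ⟨y, rfl⟩ := hG.surj z
      refine ⟨y, fun h0 => hz ?_⟩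
      have h0' : y = 0 := h0
      rw [h0', Abelian.Ext.comp_zero]
    | succ m ih =>
      obtain ⟨z, hz⟩ := ih
      refine ⟨S2.extClass.comp z (by omega), fun h0 => hz ?_⟩
      obtain ⟨w, rfl⟩ := Abelian.Ext.contravariant_sequence_exact₁ S2 _ z _ h0
      obtain ⟨y, rfl⟩ := surj _ (by omega) w
      dsimp
      rw [Abelian.Ext.mk₀_comp_mk₀_assoc, hz2, Abelian.Ext.mk₀_zero, Abelian.Ext.zero_comp]
  intro hv
  obtain ⟨z, hz⟩ := key n
  exact hz (hv _ (by omega) z)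
end


set_option linter.unusedSectionVars false
set_option linter.unusedSimpArgs false

section
open MvPowerSeries
variable {k : Type} [Field k] {σ : Type} [Fintype σ] [DecidableEq σ]

/-- The monomial ideal `(x_i^{e_i} : i ∈ S)`. -/
noncomputable def Jof (k : Type) [Field k] {σ : Type} (S : Finset σ) (e : σ → ℕ) : Ideal (MvPowerSeries σ k) :=
  Ideal.span (Set.image (fun i => (X i : MvPowerSeries σ k) ^ e i) S)

theorem X_pow_mem_Jof (S : Finset σ) (e : σ → ℕ) {i : σ} (hi : i ∈ S) {m : ℕ} (hm : e i ≤ m) :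
    (X i : MvPowerSeries σ k) ^ m ∈ Jof k S e := by
  rw [← Nat.sub_add_cancel hm, pow_add]
  exact Ideal.mul_mem_left _ _ (Ideal.subset_span ⟨i, hi, rfl⟩)

theorem Jof_insert (S : Finset σ) (e : σ → ℕ) (l : σ) :
    Jof k (insert l S) e = Jof k S e ⊔ Ideal.span {(X l : MvPowerSeries σ k) ^ e l} := by
  rw [Jof, Finset.coe_insert, Set.image_insert_eq, Ideal.span_insert, sup_comm]
  rfl

theorem mem_Jof (S : Finset σ) (e : σ → ℕ) (g : MvPowerSeries σ k) :
    g ∈ Jof k S e ↔ ∀ n : σ →₀ ℕ, (∀ i ∈ S, n i < e i) → coeff n g = 0 := by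
  constructor
  · intro h
    induction h using Submodule.span_induction with
    | mem x hx =>
      obtain ⟨i, hi, rfl⟩ := hx
      intro n hn
      exact X_pow_dvd_iff.1 (dvd_refl _) n (hn i hi)
    | zero => simp
    | add x y _ _ hx hy => intro n hn; rw [map_add, hx n hn, hy n hn, add_zero]
    | smul a x _ hx =>
      intro n hn
      rw [smul_eq_mul, coeff_mul]
      refine Finset.sum_eq_zero fun p hp => ?_
      rw [hx p.2, mul_zero]
      intro i hi
      refine lt_of_le_of_lt ?_ (hn i hi)
      rw [← Finset.HasAntidiagonal.mem_antidiagonal.1 hp]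
      simp
  · induction S using Finset.induction generalizing g with
    | empty =>
      intro h
      have : g = 0 := by ext n; simpa using h n (by simp)
      rw [this]
      exact zero_mem _
    | insert l S hl ih =>
      intro h
      let g0 : MvPowerSeries σ k := fun n => if n l < e l then coeff n g else 0
      have hg0 : ∀ n, coeff n g0 = if n l < e l then coeff n g else 0 := fun n => rfl
      have h1 : g0 ∈ Jof k S e := by
        apply ih
        intro n hn
        rw [hg0]
        split_ifs with hl
        · apply h
          intro i hi
          rcases Finset.mem_insert.1 hi with rfl | hi
          · exact hl
          · exact hn i hi
        · rfl
      have h2 : (X l : MvPowerSeries σ k) ^ e l ∣ g - g0 := by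
        rw [X_pow_dvd_iff]
        intro m hm
        rw [map_sub, hg0, if_pos hm, sub_self]
      rw [Jof_insert]
      have := add_mem (Ideal.mem_sup_left h1 : g0 ∈ Jof k S e ⊔ Ideal.span {(X l) ^ e l})
        (Ideal.mem_sup_right (Ideal.mem_span_singleton.2 h2))
      simpa using this

/-- Set the variables in `S` to zero. -/
noncomputable def restr (S : Finset σ) (g : MvPowerSeries σ k) : MvPowerSeries σ k :=
  fun n => if ∀ i ∈ S, n i = 0 then coeff n g else 0

theorem coeff_restr (S : Finset σ) (g : MvPowerSeries σ k) (n : σ →₀ ℕ) :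
    coeff n (restr S g) = if ∀ i ∈ S, n i = 0 then coeff n g else 0 := rfl

theorem restr_mul (S : Finset σ) (g h : MvPowerSeries σ k) :
    restr S (g * h) = restr S g * restr S h := by
  ext n
  rw [coeff_restr, coeff_mul, coeff_mul]
  split_ifs with hn
  · refine Finset.sum_congr rfl fun p hp => ?_
    have hp' := Finset.HasAntidiagonal.mem_antidiagonal.1 hp
    have key : ∀ i ∈ S, p.1 i = 0 ∧ p.2 i = 0 := by
      intro i hi
      have := hn i hi
      rw [← hp', Finsupp.add_apply] at this
      omega
    rw [coeff_restr, coeff_restr, if_pos (fun i hi => (key i hi).1),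
      if_pos (fun i hi => (key i hi).2)]
  · symm
    refine Finset.sum_eq_zero fun p hp => ?_
    have hp' := Finset.HasAntidiagonal.mem_antidiagonal.1 hp
    push Not at hn
    obtain ⟨i, hi, hni⟩ := hn
    rw [coeff_restr, coeff_restr]
    by_cases h1 : ∀ i ∈ S, p.1 i = 0
    · rw [if_neg (c := ∀ i ∈ S, p.2 i = 0), mul_zero]
      intro h2
      apply hni
      rw [← hp', Finsupp.add_apply, h1 i hi, h2 i hi]
    · rw [if_neg h1, zero_mul]

theorem restr_eq_zero (S : Finset σ) (g : MvPowerSeries σ k) :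
    restr S g = 0 ↔ g ∈ Jof k S 1 := by
  rw [mem_Jof]
  constructor
  · intro h n hn
    have := congrArg (coeff n) h
    rw [coeff_restr, if_pos (fun i hi => by simpa using hn i hi)] at this
    simpa using this
  · intro h
    ext n
    rw [coeff_restr]
    split_ifs with hn
    · exact h n (fun i hi => by simp [hn i hi])
    · rfl

theorem mem_Jof_of_mul (S : Finset σ) (f g : MvPowerSeries σ k) (hf : f ∉ Jof k S 1)
    (h : f * g ∈ Jof k S 1) : g ∈ Jof k S 1 := by
  rw [← restr_eq_zero] at hf h ⊢
  rw [restr_mul] at h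
  exact (mul_eq_zero.1 h).resolve_left hf

theorem coeff_sq_mul (a : MvPowerSeries σ k) (i j : σ) :
    coeff (Finsupp.single j 2) (a * X i ^ 2) = if i = j then constantCoeff a else 0 := by
  split_ifs with h
  · subst h
    have := coeff_add_mul_monomial (m := 0) (n := Finsupp.single i 2) (φ := a) (a := 1)
    rw [X_pow_eq]
    simpa using this
  · refine X_pow_dvd_iff.1 (Dvd.intro_left a rfl) _ ?_
    rw [Finsupp.single_apply, if_neg (fun h' => h h'.symm)]
    norm_num

theorem not_mem_Jof_of_unit (a : σ → MvPowerSeries σ k) (f : MvPowerSeries σ k)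
    (hf : f = ∑ i, a i * X i ^ 2) (j : σ) (hj : constantCoeff (a j) ≠ 0) (S : Finset σ)
    (hS : j ∉ S) : f ∉ Jof k S 1 := by

  rw [mem_Jof]
  intro h
  have h1 := h (Finsupp.single j 2) (by
    intro i hi
    have : i ≠ j := fun h => hS (h ▸ hi)
    simp [Finsupp.single_apply, this.symm])
  rw [hf, map_sum] at h1
  simp only [coeff_sq_mul] at h1
  simp at h1
  exact hj h1

/-- `x_l` is a nonzerodivisor modulo `(x_i : i ∈ S) + (f)`. -/
theorem regular_step (f : MvPowerSeries σ k) (S : Finset σ) (l : σ) (hl : l ∉ S)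
    (hf : f ∉ Jof k (insert l S) 1) (g : MvPowerSeries σ k)
    (h : X l * g ∈ Jof k S 1 ⊔ Ideal.span {f}) : g ∈ Jof k S 1 ⊔ Ideal.span {f} := by
  obtain ⟨u, hu, v, hv, huv⟩ := Submodule.mem_sup.1 h
  obtain ⟨q, rfl⟩ := Ideal.mem_span_singleton'.1 hv
  have hXl : (X l : MvPowerSeries σ k) ∉ Jof k S 1 := by
    rw [mem_Jof]
    intro h
    have := h (Finsupp.single l 1) (by
      intro i hi
      have : i ≠ l := fun h => hl (h ▸ hi)
      simp [Finsupp.single_apply, this.symm])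
    simp [coeff_X] at this
  have hq : q ∈ Jof k (insert l S) 1 := by
    apply mem_Jof_of_mul _ f q hf
    have e : f * q = X l * g - u := by linear_combination huv
    rw [e, Jof_insert]
    refine sub_mem (Ideal.mem_sup_right ?_) (Ideal.mem_sup_left hu)
    exact Ideal.mem_span_singleton'.2 ⟨g, by simp [mul_comm]⟩
  rw [Jof_insert] at hq
  obtain ⟨w, hw, v, hv', rfl⟩ := Submodule.mem_sup.1 hq
  obtain ⟨r, rfl⟩ := Ideal.mem_span_singleton'.1 hv'
  have h2 : g - r * f ∈ Jof k S 1 := by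
    apply mem_Jof_of_mul _ (X l) _ hXl
    have e : X l * (g - r * f) = u + w * f := by
      simp only [Pi.one_apply, pow_one] at huv
      linear_combination -huv
    rw [e]
    exact add_mem hu (Ideal.mul_mem_right _ _ hw)
  have := add_mem (Ideal.mem_sup_left h2 : _ ∈ Jof k S 1 ⊔ Ideal.span {f})
    (Ideal.mem_sup_right (Ideal.mem_span_singleton'.2 ⟨r, rfl⟩))
  simpa using this

/-- Exponents: `2` on `T`, `1` elsewhere. -/
noncomputable def eT (T : Finset σ) (i : σ) : ℕ := if i ∈ T then 2 else 1

/-- The ideal `J_T`. -/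
noncomputable def JT (k : Type) [Field k] {σ : Type} [Fintype σ] [DecidableEq σ] (T : Finset σ) :
    Ideal (MvPowerSeries σ k) := Jof k Finset.univ (eT T)

theorem eT_le_two (T : Finset σ) (i : σ) : eT T i ≤ 2 := by
  unfold eT; split_ifs <;> norm_num

theorem sq_mem_JT (T : Finset σ) (i : σ) : (X i : MvPowerSeries σ k) ^ 2 ∈ JT k T :=
  X_pow_mem_Jof _ _ (Finset.mem_univ _) (eT_le_two T i)

theorem X_mem_JT (T : Finset σ) (i : σ) (hi : i ∉ T) : (X i : MvPowerSeries σ k) ∈ JT k T := by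
  rw [← pow_one (X i)]
  exact X_pow_mem_Jof _ _ (Finset.mem_univ _) (by simp [eT, hi])

theorem JT_anti {T T' : Finset σ} (h : T ⊆ T') : JT k T' ≤ JT k T := by
  refine Ideal.span_le.2 ?_
  rintro _ ⟨i, -, rfl⟩
  refine X_pow_mem_Jof _ _ (Finset.mem_univ _) ?_
  unfold eT
  split_ifs with h1 h2
  · rfl
  · exact absurd (h h1) h2
  · norm_num
  · rfl

theorem colon_JT (T : Finset σ) (l : σ) (hl : l ∉ T) (g : MvPowerSeries σ k) :
    X l * g ∈ JT k (insert l T) ↔ g ∈ JT k T := by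
  rw [JT, JT, mem_Jof, mem_Jof]
  constructor
  · intro h n hn
    have h1 := h (n + Finsupp.single l 1) (by
      intro i _
      have := hn i (Finset.mem_univ _)
      unfold eT at this ⊢
      by_cases hil : i = l
      · subst hil
        simp only [hl, if_false] at this
        simp; omega
      · simpa [hil, Finsupp.single_apply, Ne.symm hil] using this)
    rw [mul_comm] at h1
    have := coeff_add_mul_monomial (m := n) (n := Finsupp.single l 1) (φ := g) (a := 1)
    rw [X, this, mul_one] at h1
    exact h1
  · intro h n hn
    by_cases h0 : n l = 0
    · have : (X l : MvPowerSeries σ k) ∣ X l * g := Dvd.intro _ rfl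
      exact X_dvd_iff.1 this n h0
    · obtain ⟨m, rfl⟩ : ∃ m, n = m + Finsupp.single l 1 :=
        ⟨n - Finsupp.single l 1, by
          rw [tsub_add_cancel_of_le]
          simpa [Nat.one_le_iff_ne_zero] using h0⟩
      rw [mul_comm]
      have := coeff_add_mul_monomial (m := m) (n := Finsupp.single l 1) (φ := g) (a := 1)
      rw [X, this, mul_one]
      apply h
      intro i _
      have := hn i (Finset.mem_univ _)
      unfold eT at this ⊢
      by_cases hil : i = l
      · subst hil
        simp at this
        simp [hl]; omega
      · simpa [hil, Finsupp.single_apply, Ne.symm hil] using this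

theorem JT_eq (T : Finset σ) (l : σ) (hl : l ∉ T) :
    JT k T = Jof k (Finset.univ.erase l) (eT T) ⊔ Ideal.span {(X l : MvPowerSeries σ k)} := by
  have := Jof_insert (k := k) (Finset.univ.erase l) (eT T) l
  rw [Finset.insert_erase (Finset.mem_univ _)] at this
  rw [JT, this]
  simp [eT, hl]

theorem JT_insert_eq (T : Finset σ) (l : σ) :
    JT k (insert l T) = Jof k (Finset.univ.erase l) (eT T) ⊔
      Ideal.span {(X l : MvPowerSeries σ k) ^ 2} := by
  have := Jof_insert (k := k) (Finset.univ.erase l) (eT (insert l T)) l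
  rw [Finset.insert_erase (Finset.mem_univ _)] at this
  have e : Jof k (Finset.univ.erase l) (eT (insert l T)) = Jof k (Finset.univ.erase l) (eT T) := by
    unfold Jof
    congr 1
    refine Set.image_congr fun i hi => ?_
    have : i ≠ l := by simpa using hi
    simp [eT, this]
  rw [JT, this, e]
  simp [eT]

theorem JT_le_sup (T : Finset σ) (l : σ) (hl : l ∉ T) :
    JT k T ≤ JT k (insert l T) ⊔ Ideal.span {(X l : MvPowerSeries σ k)} := by
  rw [JT_eq T l hl, JT_insert_eq T l]
  exact sup_le_sup_right le_sup_left _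

theorem nzd_erase (T : Finset σ) (l : σ) (g : MvPowerSeries σ k)
    (h : X l * g ∈ Jof k (Finset.univ.erase l) (eT T)) :
    g ∈ Jof k (Finset.univ.erase l) (eT T) := by
  rw [mem_Jof] at h ⊢
  intro n hn
  have h1 := h (n + Finsupp.single l 1) (by
    intro i hi
    have hil : i ≠ l := by simpa using hi
    simpa [Finsupp.single_apply, Ne.symm hil] using hn i hi)
  rw [mul_comm] at h1
  have := coeff_add_mul_monomial (m := n) (n := Finsupp.single l 1) (φ := g) (a := 1)
  rw [X, this, mul_one] at h1
  exact h1

theorem mem_JT_empty (g : MvPowerSeries σ k) :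
    g ∈ JT k (∅ : Finset σ) ↔ constantCoeff g = 0 := by
  rw [JT, mem_Jof]
  constructor
  · intro h
    simpa using h 0 (by simp [eT])
  · intro h n hn
    have : n = 0 := by
      ext i
      simpa [eT] using hn i (Finset.mem_univ _)
    rw [this]
    simpa using h
end


set_option linter.unusedSectionVars false
set_option linter.unusedSimpArgs false

section
open MvPowerSeries
variable {k : Type} [Field k] {σ : Type} [Fintype σ] [DecidableEq σ]

theorem f_mem_JT (a : σ → MvPowerSeries σ k) (f : MvPowerSeries σ k)
    (hf : f = ∑ i, a i * X i ^ 2) (T : Finset σ) : f ∈ JT k T := by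
  rw [hf]
  exact sum_mem fun i _ => Ideal.mul_mem_left _ _ (sq_mem_JT T i)

theorem colon_cq (a : σ → MvPowerSeries σ k) (f : MvPowerSeries σ k)
    (hf : f = ∑ i, a i * X i ^ 2) (T : Finset σ) (l : σ) (hl : l ∉ T) (g : MvPowerSeries σ k ⧸ Ideal.span {f}) :
    Ideal.Quotient.mk _ (X l) * g ∈ cq f (JT k (insert l T)) ↔ g ∈ cq f (JT k T) := by
  obtain ⟨g, rfl⟩ := Ideal.Quotient.mk_surjective g
  rw [← map_mul, mem_cq' (f_mem_JT a f hf _), mem_cq' (f_mem_JT a f hf _), colon_JT T l hl]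

theorem cq_le_sup (f : MvPowerSeries σ k) (T : Finset σ) (l : σ) (hl : l ∉ T) :
    cq f (JT k T) ≤ cq f (JT k (insert l T)) ⊔ Ideal.span {Ideal.Quotient.mk _ (X l)} := by
  refine (Ideal.map_mono (JT_le_sup T l hl)).trans ?_
  rw [Ideal.map_sup, Ideal.map_span, Set.image_singleton]

theorem mk_X_mem_cq (f : MvPowerSeries σ k) (T : Finset σ) (l : σ) (hl : l ∉ T) :
    Ideal.Quotient.mk _ (X l) ∈ cq f (JT k T) :=
  Ideal.mem_map_of_mem _ (X_mem_JT T l hl)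

theorem Jof_one_le (S T : Finset σ) (h : ∀ i ∈ S, i ∉ T) : Jof k S 1 ≤ JT k T := by
  refine Ideal.span_le.2 ?_
  rintro _ ⟨i, hi, rfl⟩
  simpa using X_mem_JT T i (h i hi)

theorem one_not_mem_cq (a : σ → MvPowerSeries σ k) (f : MvPowerSeries σ k)
    (hf : f = ∑ i, a i * X i ^ 2) : (1 : MvPowerSeries σ k ⧸ Ideal.span {f}) ∉ cq f (JT k (∅ : Finset σ)) := by
  rw [← map_one (Ideal.Quotient.mk _), mem_cq' (f_mem_JT a f hf _), mem_JT_empty]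
  simp

theorem goodE_all (a : σ → MvPowerSeries σ k) (f : MvPowerSeries σ k)
    (hf : f = ∑ i, a i * X i ^ 2) (j : σ) (hj : constantCoeff (a j) ≠ 0) (S : Finset σ) (hS : j ∉ S) :
    GoodE (cq f (Jof k S 1)) (cq f (JT k (∅ : Finset σ)))
      (Ideal.map_mono (Jof_one_le S ∅ (by simp))) S.card := by
  induction S using Finset.induction with
  | empty =>
    refine goodE_zero _ _ _ ?_ (one_not_mem_cq a f hf)
    simp [cq, Jof]
  | insert l S hl ih =>
    have hjS : j ∉ S := fun h => hS (Finset.mem_insert_of_mem h)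
    rw [Finset.card_insert_of_notMem hl]
    refine goodE_succ (Ideal.Quotient.mk _ (X l)) _ _ (cq f (JT k (insert l ∅))) _ _ _ _ (ih hjS)
      ?_ ?_ ?_ ?_ ?_ ?_ ?_ ?_
    · intro g
      obtain ⟨g, rfl⟩ := Ideal.Quotient.mk_surjective g
      rw [← map_mul, mem_cq, mem_cq]
      exact regular_step f S l hl (not_mem_Jof_of_unit a f hf j hj _ hS) g
    · rw [cq, Jof_insert, Ideal.map_sup, Ideal.map_span, Set.image_singleton]
      simp
    · refine Ideal.map_mono (Jof_one_le S _ ?_)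
      intro i hi h
      simp at h
      exact hl (h ▸ hi)
    · exact Ideal.map_mono (JT_anti (Finset.empty_subset _))
    · exact mk_X_mem_cq _ _ _ (by simp)
    · intro g hg
      exact (colon_cq a f hf ∅ l (by simp) g).2 hg
    · intro g hg
      exact (colon_cq a f hf ∅ l (by simp) g).1 hg
    · exact cq_le_sup _ _ _ (by simp)

theorem cq_erase (a : σ → MvPowerSeries σ k) (f : MvPowerSeries σ k)
    (hf : f = ∑ i, a i * X i ^ 2) (j : σ) (hj : constantCoeff (a j) ≠ 0) :
    cq f (Jof k (Finset.univ.erase j) 1) = cq f (JT k (insert j ∅)) := by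
  apply le_antisymm
  · exact Ideal.map_mono (Jof_one_le _ _ (by intro i hi; simpa using hi))
  · rw [cq, Ideal.map_le_iff_le_comap]
    refine Ideal.span_le.2 ?_
    rintro _ ⟨i, -, rfl⟩
    change Ideal.Quotient.mk _ _ ∈ cq f _
    rw [mem_cq]
    by_cases hij : i = j
    · subst hij
      have hu : IsUnit (a i) := by
        rw [MvPowerSeries.isUnit_iff_constantCoeff]
        exact hj.isUnit
      have he : eT (insert i ∅) i = 2 := by simp [eT]
      simp only [he]
      rw [← Ideal.unit_mul_mem_iff_mem _ hu]
      have : a i * X i ^ 2 = f - ∑ l ∈ Finset.univ.erase i, a l * X l ^ 2 := by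
        rw [hf, ← Finset.add_sum_erase _ _ (Finset.mem_univ i)]
        ring
      rw [this]
      refine sub_mem (Ideal.mem_sup_right (Ideal.mem_span_singleton_self f)) (Ideal.mem_sup_left ?_)
      refine sum_mem fun l hl => Ideal.mul_mem_left _ _ (X_pow_mem_Jof _ _ hl (by simp))
    · refine Ideal.mem_sup_left (X_pow_mem_Jof _ _ (by simp [hij]) ?_)
      simp [eT, hij]

theorem goodE_erase (a : σ → MvPowerSeries σ k) (f : MvPowerSeries σ k)
    (hf : f = ∑ i, a i * X i ^ 2) (j : σ) (hj : constantCoeff (a j) ≠ 0) :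
    ∃ s, GoodE (cq f (JT k (insert j ∅))) (cq f (JT k (∅ : Finset σ)))
      (Ideal.map_mono (JT_anti (Finset.empty_subset _))) s := by
  have := goodE_all a f hf j hj (Finset.univ.erase j) (by simp)
  refine ⟨(Finset.univ.erase j).card, ?_⟩
  have e := cq_erase a f hf j hj
  generalize_proofs p q at this ⊢
  revert this
  generalize cq f (Jof k (Finset.univ.erase j) 1) = B at *
  subst e
  exact id

theorem van_all (a : σ → MvPowerSeries σ k) (f : MvPowerSeries σ k)
    (hf : f = ∑ i, a i * X i ^ 2) (j : σ) (hj : constantCoeff (a j) ≠ 0) :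
    ∃ n, ∀ T : Finset σ, j ∈ T → VanE (cyc (cq f (JT k (∅ : Finset σ)))) (cyc (cq f (JT k T))) n := by
  obtain ⟨s, hs⟩ := goodE_erase a f hf j hj
  refine ⟨s + 1, fun T hT => ?_⟩
  suffices H : ∀ U : Finset σ, j ∉ U →
      VanE (cyc (cq f (JT k (∅ : Finset σ)))) (cyc (cq f (JT k (insert j U)))) (s + 1) by
    have := H (T.erase j) (by simp)
    rwa [Finset.insert_erase hT] at this
  intro U
  induction U using Finset.induction with
  | empty => intro _; exact hs.van
  | insert l U hl ih =>
    intro hjU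
    have hjl : j ≠ l := fun h => hjU (h ▸ Finset.mem_insert_self _ _)
    have ih' := ih (fun h => hjU (Finset.mem_insert_of_mem h))
    rw [Finset.insert_comm]
    have hl' : l ∉ insert j U := by simp [hl, Ne.symm hjl]
    have S := cyc_shortExact (Ideal.Quotient.mk _ (X l)) (cq f (JT k (insert j U)))
      (cq f (JT k (insert l (insert j U)))) (cq f (JT k (insert j U)))
      (fun g hg => (colon_cq a f hf _ l hl' g).2 hg)
      (one_mul_mem_of_le (Ideal.map_mono (JT_anti (Finset.subset_insert _ _))))
      (cycMap_comp_zero _ _ _ _ _ _ (mk_X_mem_cq _ _ _ hl'))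
      (fun g hg => (colon_cq a f hf _ l hl' g).1 hg)
      (cq_le_sup _ _ _ hl')
    exact VanE.mid S ih' ih'

theorem not_van_all (a : σ → MvPowerSeries σ k) (f : MvPowerSeries σ k)
    (hf : f = ∑ i, a i * X i ^ 2) (j : σ) (hj : constantCoeff (a j) ≠ 0)
    (ha : ∀ i, i ≠ j → constantCoeff (a i) = 0) (T : Finset σ) (hT : j ∉ T) (n : ℕ) :
    ¬ VanE (cyc (cq f (JT k (∅ : Finset σ)))) (cyc (cq f (JT k T))) n := by
  induction T using Finset.induction with
  | empty =>
    obtain ⟨s, hs⟩ := goodE_erase a f hf j hj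
    refine not_vanE_residue (Ideal.Quotient.mk _ (X j)) _ _ _ s hs ?_ ?_ ?_ ?_ n
    · exact mk_X_mem_cq _ _ _ (by simp)
    · intro g hg
      exact (colon_cq a f hf ∅ j (by simp) g).2 hg
    · intro g hg
      exact (colon_cq a f hf ∅ j (by simp) g).1 hg
    · exact cq_le_sup _ _ _ (by simp)
  | insert l T hl ih =>
    have hlj : l ≠ j := fun h => hT (h ▸ Finset.mem_insert_self _ _)
    intro hV
    apply ih (fun h => hT (Finset.mem_insert_of_mem h))
    rw [JT_eq T l hl]
    refine step_cq f (X l) (a l) (∑ i ∈ Finset.univ.erase l, a i * X i ^ 2) _ ?_ ?_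
      (nzd_erase T l) ?_ _ ?_ n ?_
    · exact sum_mem fun i hi => Ideal.mul_mem_left _ _ (X_pow_mem_Jof _ _ hi (eT_le_two T i))
    · rw [hf, ← Finset.sum_erase_add _ _ (Finset.mem_univ l)]
    · intro q hq
      refine (mul_eq_zero.1 hq).resolve_left ?_
      intro h0
      apply not_mem_Jof_of_unit a f hf j hj ∅ (by simp)
      rw [h0]
      exact zero_mem _
    · apply smul_id_cyc
      rw [mem_cq' (f_mem_JT a f hf _), mem_JT_empty]
      exact ha l hlj
    · rw [← JT_insert_eq]
      exact hV
end



section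
variable {Q : Type} [CommRing Q]

/-- comparison of the two models of `Q/J` as a `Q/(f)`-module -/
noncomputable def cycIso (f : Q) (J : Ideal Q) (h : Ideal.span {f} ≤ J) :
    cyc (cq f J) ≅
      @ModuleCat.of (Q ⧸ Ideal.span {f}) _ (Q ⧸ J) _
        (modOver (Ideal.span {f}) h _ (quot_isTorsionBySet Q J)) :=
  letI := modOver (Ideal.span {f}) h (Q ⧸ J) (quot_isTorsionBySet Q J)
  LinearEquiv.toModuleIso
    { (DoubleQuot.quotQuotEquivQuotOfLE h).toAddEquiv with
      map_smul' := by
        intro r x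
        obtain ⟨r, rfl⟩ := Ideal.Quotient.mk_surjective r
        obtain ⟨x, rfl⟩ := Ideal.Quotient.mk_surjective x
        obtain ⟨x, rfl⟩ := Ideal.Quotient.mk_surjective x
        rfl }

theorem vanE_iso {A : Type} [CommRing A] {K K' X X' : ModuleCat.{0} A} (e : K ≅ K') (g : X ≅ X')
    (n : ℕ) (h : VanE K X n) : VanE K' X' n := by
  intro i hi z
  have h1 := h i hi ((Abelian.Ext.mk₀ g.hom).comp (z.comp (Abelian.Ext.mk₀ e.inv) (add_zero i))
    (zero_add i))
  have h2 : (Abelian.Ext.mk₀ g.inv).comp ((((Abelian.Ext.mk₀ g.hom).comp (z.comp (Abelian.Ext.mk₀ e.inv) (add_zero i))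
    (zero_add i))).comp (Abelian.Ext.mk₀ e.hom) (add_zero i)) (zero_add i) = z := by
    simp
  rw [← h2, h1]
  simp

theorem extInf_iff (A : Type) [CommRing A] (M N : Type) [AddCommGroup M] [AddCommGroup N]
    (mM : Module A M) (mN : Module A N) :
    extInf A M N mM mN ↔
      ∀ n, ¬ VanE (@ModuleCat.of A _ N _ mN) (@ModuleCat.of A _ M _ mM) n := by
  have key : ∀ i, Nontrivial (extMod A M N mM mN (i + 1)) ↔
      ¬ Subsingleton (Abelian.Ext.{0} (@ModuleCat.of A _ M _ mM) (@ModuleCat.of A _ N _ mN) (i+1)) := by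
    intro i
    rw [← not_subsingleton_iff_nontrivial, ← oldExt_subsingleton_iff]
    rfl
  constructor
  · intro h n hV
    obtain ⟨i, hi, hn⟩ := h (n + 1)
    obtain ⟨i, rfl⟩ : ∃ j, i = j + 1 := ⟨i - 1, by omega⟩
    rw [key] at hn
    exact hn ⟨fun x y => by rw [hV _ (by omega) x, hV _ (by omega) y]⟩
  · intro h n
    by_contra hcon
    push Not at hcon
    apply h (n + 1)
    intro i hi z
    obtain ⟨i, rfl⟩ : ∃ j, i = j + 1 := ⟨i - 1, by omega⟩
    have h1 : ¬ Nontrivial (extMod A M N mM mN (i + 1)) := by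
      rw [not_nontrivial_iff_subsingleton]
      exact hcon _ (by omega)
    rw [key, not_not] at h1
    exact Subsingleton.elim _ _

theorem extInf_cyc (f : Q) (J L : Ideal Q) (hJ : Ideal.span {f} ≤ J) (hL : Ideal.span {f} ≤ L) :
    extInf (Q ⧸ Ideal.span {f}) (Q ⧸ J) (Q ⧸ L)
      (modOver (Ideal.span {f}) hJ _ (quot_isTorsionBySet Q J))
      (modOver (Ideal.span {f}) hL _ (quot_isTorsionBySet Q L)) ↔
      ∀ n, ¬ VanE (cyc (cq f L)) (cyc (cq f J)) n := by
  rw [extInf_iff]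
  refine forall_congr' fun n => not_congr ⟨?_, ?_⟩
  · exact vanE_iso (cycIso f L hL).symm (cycIso f J hJ).symm n
  · exact vanE_iso (cycIso f L hL) (cycIso f J hJ) n
end

section
open MvPowerSeries
variable {k : Type} [Field k] {σ : Type} [Fintype σ] [DecidableEq σ]

theorem JT_empty_eq : JT k (∅ : Finset σ) = Ideal.span (Set.range (X : σ → MvPowerSeries σ k)) := by
  rw [JT, Jof]
  congr 1
  ext y
  simp [eT]

theorem JT_erase_eq (j : σ) : JT k (Finset.univ.erase j) =
    Ideal.span (Set.range fun i => (X i : MvPowerSeries σ k) ^ 2) ⊔ Ideal.span {X j} := by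
  apply le_antisymm
  · refine Ideal.span_le.2 ?_
    rintro _ ⟨i, -, rfl⟩
    by_cases hij : i = j
    · subst hij
      refine Ideal.mem_sup_right ?_
      simpa [eT] using Ideal.mem_span_singleton_self _
    · refine Ideal.mem_sup_left (Ideal.subset_span ⟨i, ?_⟩)
      simp [eT, hij]
  · refine sup_le (Ideal.span_le.2 ?_) ?_
    · rintro _ ⟨i, rfl⟩
      exact sq_mem_JT _ i
    · rw [Ideal.span_singleton_le_iff_mem]
      exact X_mem_JT _ _ (by simp)

theorem mem_sq_iff (f : MvPowerSeries σ k) :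
    f ∈ Ideal.span (Set.range fun i => (X i : MvPowerSeries σ k) ^ 2) ↔
      ∃ a : σ → MvPowerSeries σ k, f = ∑ i, a i * X i ^ 2 := by
  rw [Ideal.mem_span_range_iff_exists_fun]
  exact exists_congr fun a => eq_comm

theorem mem_mul_sq_iff (f : MvPowerSeries σ k) :
    f ∈ JT k (∅ : Finset σ) * Ideal.span (Set.range fun i => (X i : MvPowerSeries σ k) ^ 2) ↔
      ∃ a : σ → MvPowerSeries σ k, (∀ i, constantCoeff (a i) = 0) ∧ f = ∑ i, a i * X i ^ 2 := by
  constructor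
  · intro h
    refine Submodule.mul_induction_on h ?_ ?_
    · intro m hm n hn
      obtain ⟨a, rfl⟩ := (mem_sq_iff n).1 hn
      rw [mem_JT_empty] at hm
      refine ⟨fun i => m * a i, fun i => by simp [hm], ?_⟩
      rw [Finset.mul_sum]
      simp [mul_assoc]
    · rintro x y ⟨a, ha, rfl⟩ ⟨b, hb, rfl⟩
      refine ⟨fun i => a i + b i, fun i => by simp [ha, hb], ?_⟩
      simp [add_mul, Finset.sum_add_distrib]
  · rintro ⟨a, ha, rfl⟩
    exact sum_mem fun i _ => Ideal.mul_mem_mul ((mem_JT_empty _).2 (ha i))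
      (Ideal.subset_span ⟨i, rfl⟩)
end


/-- For `R = k[[x₁,…,x_c]]/(x₁²,…,x_c²)` and `M = R/(x₁)`, the first-order
support variety of `M` is the single point corresponding to the line spanned by `x₁²`. -/
theorem statement14 (k : Type) [Field k] (c : ℕ) (hc : 0 < c)
    (𝔫 : Ideal (MvPowerSeries (Fin c) k))
    (h𝔫 : 𝔫 = Ideal.span (Set.range (MvPowerSeries.X : Fin c → MvPowerSeries (Fin c) k)))
    (I : Ideal (MvPowerSeries (Fin c) k))
    (hI : I = Ideal.span (Set.range fun i => (MvPowerSeries.X i : MvPowerSeries (Fin c) k) ^ 2))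
    (hIsq : I ≤ 𝔫 ^ 2) :
    ∀ (f₀ : MvPowerSeries (Fin c) k) (hf₀ : f₀ ∈ I), f₀ ∉ 𝔫 * I →
      (extInf (MvPowerSeries (Fin c) k ⧸ Ideal.span {f₀})
          (MvPowerSeries (Fin c) k ⧸
            (I ⊔ Ideal.span {(MvPowerSeries.X (⟨0, hc⟩ : Fin c) : MvPowerSeries (Fin c) k)}))
          (MvPowerSeries (Fin c) k ⧸ 𝔫)
          (modOver (Ideal.span {f₀})
            ((Ideal.span_singleton_le_iff_mem _).mpr (Ideal.mem_sup_left hf₀))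
            _ (quot_isTorsionBySet _
                (I ⊔ Ideal.span {(MvPowerSeries.X (⟨0, hc⟩ : Fin c) : MvPowerSeries (Fin c) k)})))
          (modOver (Ideal.span {f₀})
            ((Ideal.span_singleton_le_iff_mem 𝔫).mpr
              ((hIsq.trans (Ideal.pow_le_self two_ne_zero)) hf₀))
            _ (quot_isTorsionBySet _ 𝔫)) ↔
        f₀ ∈ Ideal.span {(MvPowerSeries.X (⟨0, hc⟩ : Fin c) : MvPowerSeries (Fin c) k) ^ 2}
          ⊔ 𝔫 * I) := by
  intro f hf hfn
  have h𝔫' : 𝔫 = JT k (∅ : Finset (Fin c)) := by rw [h𝔫, JT_empty_eq]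
  rw [extInf_cyc, hI, ← JT_erase_eq, h𝔫']
  rw [h𝔫', hI, mem_mul_sq_iff] at hfn
  rw [hI, mem_sq_iff] at hf
  obtain ⟨a, ha⟩ := hf
  constructor
  · intro h
    have hz : ∀ j : Fin c, j ≠ ⟨0, hc⟩ → MvPowerSeries.constantCoeff (a j) = 0 := by
      intro j hj
      by_contra hne
      obtain ⟨n, hn⟩ := van_all a f ha j hne
      exact h n (hn _ (by simp [hj]))
    rw [ha, ← Finset.add_sum_erase _ _ (Finset.mem_univ (⟨0, hc⟩ : Fin c))]
    refine add_mem (Ideal.mem_sup_left ?_) (Ideal.mem_sup_right ?_)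
    · exact Ideal.mul_mem_left _ _ (Ideal.mem_span_singleton_self _)
    · refine sum_mem fun i hi => Ideal.mul_mem_mul ((mem_JT_empty _).2 (hz i ?_))
        (Ideal.subset_span ⟨i, rfl⟩)
      simpa using hi
  · intro h
    obtain ⟨u, hu, v, hv, huv⟩ := Submodule.mem_sup.1 h
    obtain ⟨r, rfl⟩ := Ideal.mem_span_singleton'.1 hu
    obtain ⟨b, hb, rfl⟩ := (mem_mul_sq_iff v).1 hv
    have hsum : f = ∑ i, (b i + if i = ⟨0, hc⟩ then r else 0) * MvPowerSeries.X i ^ 2 := by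
      rw [← huv]
      simp only [add_mul, Finset.sum_add_distrib, ite_mul, zero_mul, Finset.sum_ite_eq',
        Finset.mem_univ, if_true]
      ring
    have hother : ∀ i : Fin c, i ≠ ⟨0, hc⟩ →
        MvPowerSeries.constantCoeff (b i + if i = ⟨0, hc⟩ then r else 0) = 0 := by
      intro i hi
      simp [hb, hi]
    intro n
    refine not_van_all _ f hsum ⟨0, hc⟩ ?_ hother _ (by simp) n
    intro h0
    apply hfn
    refine ⟨_, ?_, hsum⟩
    intro i
    by_cases hi : i = ⟨0, hc⟩
    · subst hi
      exact h0
    · exact hother i hi
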